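/- arXiv:2505.06756 — 6 statements merged into one kernel-verified Lean document; each statement's English description precedes it below -/
import Mathlib

section
/- Let X = U_d Σ_d be an n×d real matrix, where U_d has orthonormal columns (U_dᵀ U_d = I_d) and Σ_d is a d×d invertible diagonal matrix, and suppose X is centered: Xᵀ e = 0, where e = (1,…,1) ∈ ℝ^n. Let b ∈ ℝ^n, α ∈ ℝ, and set y = Σ_d^{-1} U_dᵀ (b + α e). Then Xᵀ X y = Xᵀ b. Consequently, since XᵀX is invertible, the Landmark MDS triangulation embedding y = Σ_d^{-1} U_dᵀ (b + αe) equals the least squares solution (XᵀX)^{-1} Xᵀ b. -/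
open Matrix BigOperators

/-- For a centered configuration `X = U_d Σ_d` (`Xᵀe = 0`), the Landmark MDS
triangulation embedding `y = Σ_d⁻¹ U_dᵀ (b + α e)` satisfies the normal
equations `XᵀX y = Xᵀ b` and hence equals the least squares solution
`(XᵀX)⁻¹ Xᵀ b`. -/
theorem landmark_mds_equals_least_squares
    (n d : ℕ)
    (Ud : Matrix (Fin n) (Fin d) ℝ) (hUd : Udᵀ * Ud = 1)
    (σ : Fin d → ℝ) (hσ : ∀ i, σ i ≠ 0)
    (X : Matrix (Fin n) (Fin d) ℝ) (hX : X = Ud * Matrix.diagonal σ)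
    (e : Fin n → ℝ) (he : e = fun _ => 1)
    (hcent : Xᵀ *ᵥ e = 0)
    (b : Fin n → ℝ) (α : ℝ)
    (y : Fin d → ℝ)
    (hy : y = (Matrix.diagonal σ)⁻¹ *ᵥ (Udᵀ *ᵥ (b + α • e))) :
    (Xᵀ * X) *ᵥ y = Xᵀ *ᵥ b ∧ y = (Xᵀ * X)⁻¹ *ᵥ (Xᵀ *ᵥ b) := by
  have hdet : IsUnit (Matrix.diagonal σ).det := by
    rw [Matrix.det_diagonal, isUnit_iff_ne_zero]
    exact Finset.prod_ne_zero_iff.mpr fun i _ => hσ i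
  have hXt : Xᵀ = Matrix.diagonal σ * Udᵀ := by
    rw [hX, Matrix.transpose_mul, Matrix.diagonal_transpose]
  have hgram : Xᵀ * X = Matrix.diagonal σ * Matrix.diagonal σ := by
    rw [hXt, hX, Matrix.mul_assoc, ← Matrix.mul_assoc Udᵀ, hUd, Matrix.one_mul]
  have hnormal : (Xᵀ * X) *ᵥ y = Xᵀ *ᵥ b := by
    calc (Xᵀ * X) *ᵥ y = Xᵀ *ᵥ (b + α • e) := by
          rw [hgram, hy, Matrix.mulVec_mulVec, Matrix.mul_assoc,
            Matrix.mul_nonsing_inv _ hdet, Matrix.mul_one, Matrix.mulVec_mulVec, hXt]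
      _ = Xᵀ *ᵥ b := by
          rw [Matrix.mulVec_add, Matrix.mulVec_smul, hcent, smul_zero, add_zero]
  have hgram_det : IsUnit (Xᵀ * X).det := by
    rw [hgram, Matrix.det_mul]
    exact hdet.mul hdet
  refine ⟨hnormal, ?_⟩
  rw [← hnormal, Matrix.mulVec_mulVec, Matrix.nonsing_inv_mul _ hgram_det, Matrix.one_mulVec]
end

section
/- Let X be an n×d real matrix, b ∈ ℝ^n, β ∈ ℝ, and let B̄ = X Xᵀ. Let B̄⁺ be the (n+1)×(n+1) block matrix with top-left block B̄, top-right column b, bottom-left row bᵀ, and bottom-right entry β. Then for every y ∈ ℝ^d, the squared Frobenius distance between the (n+1)×(n+1) inner product matrix of the augmented configuration (whose first n rows are the rows of X and whose last row is yᵀ) and B̄⁺ equals 2‖Xy − b‖₂² + (yᵀy − β)². -/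
open Matrix BigOperators

/-- Restricted reconstruction objective for one new point: the squared
Frobenius distance between the inner product matrix of the augmented
configuration (rows of `X` followed by `yᵀ`) and the block matrix
`B̄⁺ = [[XXᵀ, b],[bᵀ, β]]` equals `2‖Xy − b‖₂² + (yᵀy − β)²`. -/
theorem restricted_reconstruction_objective
    (n d : ℕ)
    (X : Matrix (Fin n) (Fin d) ℝ) (b : Fin n → ℝ) (β : ℝ)
    (Bplus : Matrix (Fin n ⊕ Unit) (Fin n ⊕ Unit) ℝ)
    (hBplus : Bplus = Matrix.fromBlocks (X * Xᵀ)
        (Matrix.of fun i (_ : Unit) => b i)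
        (Matrix.of fun (_ : Unit) j => b j)
        (Matrix.of fun (_ : Unit) (_ : Unit) => β))
    (y : Fin d → ℝ)
    (W : Matrix (Fin n ⊕ Unit) (Fin d) ℝ)
    (hW : W = Matrix.of (Sum.elim (fun i j => X i j) (fun _ j => y j))) :
    ∑ i, ∑ j, ((W * Wᵀ - Bplus) i j) ^ 2
      = 2 * (∑ i, ((X *ᵥ y) i - b i) ^ 2) + ((∑ j, y j ^ 2) - β) ^ 2 := by
  subst hBplus hW
  simp only [Fintype.sum_sum_type, Finset.univ_unique, Finset.sum_singleton, Matrix.sub_apply,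
    Matrix.mul_apply, Matrix.transpose_apply, Matrix.of_apply, Matrix.fromBlocks_apply₁₁,
    Matrix.fromBlocks_apply₁₂, Matrix.fromBlocks_apply₂₁, Matrix.fromBlocks_apply₂₂,
    Sum.elim_inl, Sum.elim_inr, Matrix.mulVec, dotProduct, sub_self, mul_comm (y _), ← pow_two,
    ne_eq, OfNat.ofNat_ne_zero, not_false_eq_true, zero_pow, Finset.sum_const_zero, zero_add]
  ring
end

section
/- Let X be an n×d real matrix, b ∈ ℝ^n, and λ ∈ ℝ such that XᵀX + λI_d is positive semidefinite. Suppose y₀ ∈ ℝ^d satisfies (XᵀX + λI_d) y₀ = Xᵀ b. Then y₀ is a global minimizer of y ↦ ‖b − Xy‖₂² over the sphere {y ∈ ℝ^d : yᵀy = y₀ᵀy₀}; that is, for every y ∈ ℝ^d with yᵀy = y₀ᵀy₀, ‖b − Xy‖₂² ≥ ‖b − Xy₀‖₂². -/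
open Matrix BigOperators

/-- Completing the square for the regularized least squares objective at a solution `y₀` of the
regularized normal equations. -/
theorem regularized_leastSquares_sub_eq {m n : Type*} [Fintype m] [Fintype n] [DecidableEq n]
    (X : Matrix m n ℝ) (b : m → ℝ) (l : ℝ) (y₀ : n → ℝ)
    (h₀ : (Xᵀ * X + l • (1 : Matrix n n ℝ)) *ᵥ y₀ = Xᵀ *ᵥ b) (y : n → ℝ) :
    ((b - X *ᵥ y) ⬝ᵥ (b - X *ᵥ y) + l * (y ⬝ᵥ y)) -
        ((b - X *ᵥ y₀) ⬝ᵥ (b - X *ᵥ y₀) + l * (y₀ ⬝ᵥ y₀)) =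
      (y - y₀) ⬝ᵥ ((Xᵀ * X + l • (1 : Matrix n n ℝ)) *ᵥ (y - y₀)) := by
  have bilin (u v : n → ℝ) : u ⬝ᵥ ((Xᵀ * X + l • (1 : Matrix n n ℝ)) *ᵥ v) =
      (X *ᵥ u) ⬝ᵥ (X *ᵥ v) + l * (u ⬝ᵥ v) := by
    rw [add_mulVec, dotProduct_add, smul_mulVec, one_mulVec, dotProduct_smul, smul_eq_mul,
      ← mulVec_mulVec, dotProduct_mulVec, vecMul_transpose]
  have normal (u : n → ℝ) : (X *ᵥ u) ⬝ᵥ (X *ᵥ y₀) + l * (u ⬝ᵥ y₀) = (X *ᵥ u) ⬝ᵥ b := by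
    rw [← bilin, h₀, dotProduct_mulVec, vecMul_transpose]
  have hy := normal y
  have hy₀ := normal y₀
  rw [bilin]
  simp only [mulVec_sub, sub_dotProduct, dotProduct_sub]
  rw [dotProduct_comm b (X *ᵥ y), dotProduct_comm b (X *ᵥ y₀), dotProduct_comm y₀ y,
    dotProduct_comm (X *ᵥ y₀) (X *ᵥ y)]
  linarith

/-- Global optimality condition for norm-constrained least squares (the
trust-region subproblem): if `XᵀX + λI` is positive semidefinite and
`(XᵀX + λI) y₀ = Xᵀ b`, then `y₀` globally minimizes `‖b − Xy‖₂²` over the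
sphere `{y : yᵀy = y₀ᵀy₀}`. -/
theorem trust_region_global_optimality
    (n d : ℕ) (X : Matrix (Fin n) (Fin d) ℝ) (b : Fin n → ℝ) (l : ℝ)
    (hpsd : (Xᵀ * X + l • (1 : Matrix (Fin d) (Fin d) ℝ)).PosSemidef)
    (y₀ : Fin d → ℝ)
    (h₀ : (Xᵀ * X + l • (1 : Matrix (Fin d) (Fin d) ℝ)) *ᵥ y₀ = Xᵀ *ᵥ b) :
    ∀ y : Fin d → ℝ, (∑ j, y j ^ 2) = (∑ j, y₀ j ^ 2) →
      (∑ i, (b i - (X *ᵥ y) i) ^ 2) ≥ ∑ i, (b i - (X *ᵥ y₀) i) ^ 2 := by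
  intro y hy
  have hquad := regularized_leastSquares_sub_eq X b l y₀ h₀ y
  have hnonneg := hpsd.dotProduct_mulVec_nonneg (y - y₀)
  rw [star_trivial, ← hquad] at hnonneg
  simp only [dotProduct, Pi.sub_apply, ← sq, hy] at hnonneg
  linarith
end

section
/- Define f : ℝ² → ℝ by f(θ, y) = (3/2) y² − 18 y sin θ − 4 cos θ + 58. Then the gradient of f vanishes at (0, 0), but (0, 0) is not a local minimizer of f: for every ε > 0 there exists (θ, y) with ‖(θ, y) − (0, 0)‖ < ε and f(θ, y) < f(0, 0) = 54. (That is, (0,0) is a saddle point of f.) -/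
open Real

/-- For `f(θ, y) = (3/2)y² − 18y sin θ − 4 cos θ + 58`, the gradient vanishes
at `(0,0)`, `f(0,0) = 54`, yet `(0,0)` is not a local minimizer: arbitrarily
close to `(0,0)` there are points with strictly smaller value. Thus `(0,0)` is
a saddle point. -/
theorem projection_point_is_saddle
    (f : ℝ × ℝ → ℝ)
    (hf : ∀ p : ℝ × ℝ,
      f p = (3/2) * p.2 ^ 2 - 18 * p.2 * Real.sin p.1 - 4 * Real.cos p.1 + 58) :
    fderiv ℝ f ((0 : ℝ), (0 : ℝ)) = 0 ∧
    f ((0 : ℝ), (0 : ℝ)) = 54 ∧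
    ∀ ε > (0 : ℝ), ∃ p : ℝ × ℝ,
      ‖p - ((0 : ℝ), (0 : ℝ))‖ < ε ∧ f p < f ((0 : ℝ), (0 : ℝ)) := by
  obtain rfl : f = fun p => (3/2) * p.2 ^ 2 - 18 * p.2 * sin p.1 - 4 * cos p.1 + 58 :=
    funext hf
  refine ⟨?_, by norm_num, fun ε hε => ?_⟩
  · have h1 : HasFDerivAt (fun p : ℝ × ℝ => p.1) (ContinuousLinearMap.fst ℝ ℝ ℝ) (0, 0) :=
      hasFDerivAt_fst
    have h2 : HasFDerivAt (fun p : ℝ × ℝ => p.2) (ContinuousLinearMap.snd ℝ ℝ ℝ) (0, 0) :=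
      hasFDerivAt_snd
    have h := ((((h2.pow 2).const_mul (3/2)).sub ((h2.const_mul 18).mul h1.sin)).sub
      (h1.cos.const_mul 4)).add_const 58
    refine h.fderiv.trans ?_
    ext <;> simp
  · obtain ⟨t, ht0, ht⟩ := exists_between (lt_min hε one_pos)
    obtain ⟨htε, ht1⟩ := lt_min_iff.mp ht
    refine ⟨(t, t), by simpa [Prod.norm_def, abs_of_pos ht0] using htε, ?_⟩
    have hsin := mul_lt_mul_of_pos_left (sin_gt_sub_cube ht0) ht0
    have hcos := one_sub_sq_div_two_le_cos (x := t)
    have ht4 : t ^ 4 < t ^ 2 := pow_lt_pow_right_of_lt_one₀ ht0 ht1 (by norm_num)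
    simp only [sin_zero, cos_zero]
    nlinarith [pow_pos ht0 2]
end

section
/- Define f : ℝ² → ℝ by f(θ, y) = (3/2) y² − 18 y sin θ − 4 cos θ + 58. Then for all (θ, y) ∈ ℝ², f(θ, y) ≥ 106/27, and equality holds if and only if cos θ = 1/27 and y = 6 sin θ. In particular, all global minimizers of f satisfy cos θ = 1/27 and y = 6 sin θ, and f attains the same minimal value 106/27 at each of them. -/
open Real

/-- For `f(θ, y) = (3/2)y² − 18y sin θ − 4 cos θ + 58`, one has
`f(θ, y) ≥ 106/27` for all `(θ, y)`, with equality if and only if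
`cos θ = 1/27` and `y = 6 sin θ`. In particular every global minimizer
satisfies these equations and `f` attains the common minimal value `106/27`
at each of them. -/
theorem restricted_reconstruction_global_minimizers
    (f : ℝ → ℝ → ℝ)
    (hf : ∀ θ y : ℝ,
      f θ y = (3/2) * y ^ 2 - 18 * y * Real.sin θ - 4 * Real.cos θ + 58) :
    ∀ θ y : ℝ, 106/27 ≤ f θ y ∧
      (f θ y = 106/27 ↔ (Real.cos θ = 1/27 ∧ y = 6 * Real.sin θ)) := by
  intro θ y
  have key : f θ y = 3/2 * (y - 6 * Real.sin θ) ^ 2 + 54 * (Real.cos θ - 1/27) ^ 2 + 106/27 := by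
    rw [hf]
    linear_combination (-54) * Real.sin_sq_add_cos_sq θ
  have hy := sq_nonneg (y - 6 * Real.sin θ)
  have hc := sq_nonneg (Real.cos θ - 1/27)
  refine ⟨by linarith, fun h => ?_, fun ⟨h₁, h₂⟩ => ?_⟩
  · have hc₀ : (Real.cos θ - 1/27) ^ 2 = 0 := by linarith
    have hy₀ : (y - 6 * Real.sin θ) ^ 2 = 0 := by linarith
    exact ⟨sub_eq_zero.mp (pow_eq_zero_iff two_ne_zero |>.mp hc₀),
      sub_eq_zero.mp (pow_eq_zero_iff two_ne_zero |>.mp hy₀)⟩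
  · rw [key, h₁, h₂]
    ring
end

section
/- Define F : ℝ² → ℝ by F(y₁, y₂) = 100 y₁² + 64 y₂² + (y₁² + y₂² − 400)². Then for all (y₁, y₂) ∈ ℝ², F(y₁, y₂) ≥ 24576, and equality holds if and only if (y₁, y₂) = (0, √368) or (y₁, y₂) = (0, −√368). That is, the restricted reconstruction objective of Example 2 has exactly two global minimizers, y* = (0, ±√368). -/
open Real

/-- The restricted reconstruction objective of Example 2,
`F(y₁, y₂) = 100y₁² + 64y₂² + (y₁² + y₂² − 400)²`, satisfies
`F(y₁, y₂) ≥ 24576` everywhere, with equality if and only if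
`(y₁, y₂) = (0, √368)` or `(y₁, y₂) = (0, −√368)`; i.e., `F` has exactly two
global minimizers `y* = (0, ±√368)`. -/
theorem example2_global_minimizers
    (F : ℝ → ℝ → ℝ)
    (hF : ∀ y₁ y₂ : ℝ,
      F y₁ y₂ = 100 * y₁ ^ 2 + 64 * y₂ ^ 2 + (y₁ ^ 2 + y₂ ^ 2 - 400) ^ 2) :
    ∀ y₁ y₂ : ℝ, 24576 ≤ F y₁ y₂ ∧
      (F y₁ y₂ = 24576 ↔
        ((y₁, y₂) = ((0 : ℝ), Real.sqrt 368) ∨ (y₁, y₂) = ((0 : ℝ), -Real.sqrt 368))) := by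
  intro y₁ y₂
  have hsq : F y₁ y₂ = 36 * y₁ ^ 2 + (y₁ ^ 2 + y₂ ^ 2 - 368) ^ 2 + 24576 := by
    rw [hF]; ring
  have hsqrt : Real.sqrt 368 ^ 2 = 368 := Real.sq_sqrt (by norm_num)
  refine ⟨by rw [hsq]; nlinarith [sq_nonneg y₁, sq_nonneg (y₁ ^ 2 + y₂ ^ 2 - 368)], ?_, ?_⟩
  · intro h
    have hy₁ : y₁ = 0 := by
      apply pow_eq_zero_iff two_ne_zero |>.mp
      nlinarith [sq_nonneg y₁, sq_nonneg (y₁ ^ 2 + y₂ ^ 2 - 368)]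
    subst hy₁
    have hy₂ : y₂ ^ 2 - 368 = 0 := by
      apply pow_eq_zero_iff two_ne_zero |>.mp
      linear_combination h - hsq
    have : y₂ ^ 2 = Real.sqrt 368 ^ 2 := by linarith
    simpa using sq_eq_sq_iff_eq_or_eq_neg.mp this
  · rintro (h | h) <;> obtain ⟨rfl, rfl⟩ := Prod.mk.inj h <;> rw [hsq]
    · rw [hsqrt]; norm_num
    · rw [neg_sq, hsqrt]; norm_num
end
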